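/- arXiv:1202.2945 — 2 statements merged into one kernel-verified Lean document; each statement's English description precedes it below -/
import Mathlib

section
/- Let (X, 𝒳) be a measurable space, let K_1, …, K_n be Markov (probability) kernels on (X, 𝒳), and suppose there exist ε ∈ (0, 1] and probability measures μ_1, …, μ_n on (X, 𝒳) such that K_i(x, A) ≥ ε·μ_i(A) for all i ∈ {1, …, n}, all x ∈ X and all A ∈ 𝒳. Then for any two probability measures η and η' on (X, 𝒳) and any bounded measurable function h : X → ℝ, |η K_1 ⋯ K_n (h) − η' K_1 ⋯ K_n (h)| ≤ (1 − ε)^n · osc(h). -/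
open MeasureTheory ProbabilityTheory

lemma int_of_bdd {X : Type*} [MeasurableSpace X] (p : Measure X) [IsFiniteMeasure p]
    (h : X → ℝ) (hh : Measurable h) (a b : ℝ) (ha : ∀ x, a ≤ h x) (hb : ∀ x, h x ≤ b) :
    Integrable h p :=
  Integrable.of_mem_Icc a b hh.aemeasurable (Filter.Eventually.of_forall fun x => ⟨ha x, hb x⟩)

lemma minor_lower {X : Type*} [MeasurableSpace X] (p μ : Measure X) [IsProbabilityMeasure p]
    [IsProbabilityMeasure μ] (ε : ℝ) (hε₀ : 0 ≤ ε)
    (hm : ∀ A : Set X, MeasurableSet A → ENNReal.ofReal ε * μ A ≤ p A)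
    (h : X → ℝ) (hh : Measurable h) (a b : ℝ) (ha : ∀ x, a ≤ h x) (hb : ∀ x, h x ≤ b) :
    ε * ∫ x, h x ∂μ + (1 - ε) * a ≤ ∫ x, h x ∂p := by
  have hle : ENNReal.ofReal ε • μ ≤ p := by
    rw [Measure.le_iff]
    intro s hs
    simpa using hm s hs
  have ip := int_of_bdd p h hh a b ha hb
  have im := int_of_bdd μ h hh a b ha hb
  have key := integral_mono_measure (f := fun x => h x - a) hle
    (Filter.Eventually.of_forall fun x => by simpa using ha x) (ip.sub (integrable_const a))
  rw [integral_smul_measure, integral_sub im (integrable_const a),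
    integral_sub ip (integrable_const a), ENNReal.toReal_ofReal hε₀] at key
  simp at key
  linarith

lemma minor_upper {X : Type*} [MeasurableSpace X] (p μ : Measure X) [IsProbabilityMeasure p]
    [IsProbabilityMeasure μ] (ε : ℝ) (hε₀ : 0 ≤ ε)
    (hm : ∀ A : Set X, MeasurableSet A → ENNReal.ofReal ε * μ A ≤ p A)
    (h : X → ℝ) (hh : Measurable h) (a b : ℝ) (ha : ∀ x, a ≤ h x) (hb : ∀ x, h x ≤ b) :
    ∫ x, h x ∂p ≤ ε * ∫ x, h x ∂μ + (1 - ε) * b := by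
  have := minor_lower p μ ε hε₀ hm (fun x => - h x) hh.neg (-b) (-a)
    (fun x => neg_le_neg (hb x)) (fun x => neg_le_neg (ha x))
  rw [integral_neg, integral_neg] at this
  linarith

lemma prob_foldl {X : Type*} [MeasurableSpace X] (n : ℕ)
    (K : Fin n → Kernel X X) [∀ i, IsMarkovKernel (K i)]
    (η : Measure X) [IsProbabilityMeasure η] :
    IsProbabilityMeasure (List.foldl Measure.bind η (List.ofFn fun i => ⇑(K i))) := by
  induction n with
  | zero => simpa
  | succ n ih =>
    rw [List.ofFn_succ_last, List.foldl_append]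
    have := ih (fun i => K i.castSucc)
    simp only [List.foldl_cons, List.foldl_nil]
    infer_instance

lemma bind_integral {X : Type*} [MeasurableSpace X] (ν : Measure X) (κ : Kernel X X)
    (h : X → ℝ) (hi : Integrable h (Measure.bind ν κ)) :
    ∫ x, h x ∂(Measure.bind ν κ) = ∫ x, ∫ y, h y ∂(κ x) ∂ν := by
  have e : (κ ∘ₖ Kernel.const Unit ν) () = Measure.bind ν κ := by
    rw [Kernel.comp_apply, Kernel.const_apply]
  have := Kernel.integral_comp (η := κ) (κ := Kernel.const Unit ν) (a := ()) (f := h)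
    (by rw [e]; exact hi)
  rwa [e, Kernel.const_apply] at this

lemma main_aux {X : Type*} [MeasurableSpace X] (n : ℕ)
    (K : Fin n → Kernel X X) [∀ i, IsMarkovKernel (K i)]
    (ε : ℝ) (hε₀ : 0 < ε) 
    (μ : Fin n → Measure X) [∀ i, IsProbabilityMeasure (μ i)]
    (hminor : ∀ i x (A : Set X), MeasurableSet A →
      ENNReal.ofReal ε * μ i A ≤ K i x A)
    (η η' : Measure X) [IsProbabilityMeasure η] [IsProbabilityMeasure η']
    (h : X → ℝ) (hh : Measurable h) (a b : ℝ) (ha : ∀ x, a ≤ h x) (hb : ∀ x, h x ≤ b) :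
    |(∫ x, h x ∂(List.foldl Measure.bind η (List.ofFn fun i => ⇑(K i)))) -
        ∫ x, h x ∂(List.foldl Measure.bind η' (List.ofFn fun i => ⇑(K i)))| ≤
      (1 - ε) ^ n * (b - a) := by
  induction n generalizing h a b with
  | zero =>
    have l1 := minor_lower η η 0 le_rfl (by simp) h hh a b ha hb
    have u1 := minor_upper η η 0 le_rfl (by simp) h hh a b ha hb
    have l2 := minor_lower η' η' 0 le_rfl (by simp) h hh a b ha hb
    have u2 := minor_upper η' η' 0 le_rfl (by simp) h hh a b ha hb
    simp only [List.ofFn_zero, List.foldl_nil]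
    rw [abs_le]
    constructor <;> simp at * <;> linarith
  | succ n ih =>
    rw [List.ofFn_succ_last, List.foldl_append, List.foldl_append]
    simp only [List.foldl_cons, List.foldl_nil]
    have p1 := prob_foldl n (fun i => K i.castSucc) η
    have p2 := prob_foldl n (fun i => K i.castSucc) η'
    rw [bind_integral _ _ _ (int_of_bdd _ h hh a b ha hb),
      bind_integral _ _ _ (int_of_bdd _ h hh a b ha hb)]
    have := ih (fun i => K i.castSucc) (fun i => μ i.castSucc) (fun i => hminor i.castSucc)
      (fun x => ∫ y, h y ∂(K (Fin.last n) x))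
      (hh.stronglyMeasurable.integral_kernel).measurable _ _
      (fun x => minor_lower _ (μ (Fin.last n)) ε hε₀.le (hminor _ x) h hh a b ha hb)
      (fun x => minor_upper _ (μ (Fin.last n)) ε hε₀.le (hminor _ x) h hh a b ha hb)
    refine this.trans (le_of_eq ?_)
    ring


/-- Uniform Doeblin minorization implies exponential contraction in total variation
for products of Markov kernels: if each `K i` dominates `ε μ i`, then for any two
initial probability measures `η`, `η'` and any bounded measurable `h`,
`|η K₁ ⋯ Kₙ (h) − η' K₁ ⋯ Kₙ (h)| ≤ (1 − ε)^n osc(h)`. -/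
theorem stmt_6 {X : Type*} [MeasurableSpace X] (n : ℕ)
    (K : Fin n → Kernel X X) [∀ i, IsMarkovKernel (K i)]
    (ε : ℝ) (hε₀ : 0 < ε) (hε₁ : ε ≤ 1)
    (μ : Fin n → Measure X) [∀ i, IsProbabilityMeasure (μ i)]
    (hminor : ∀ i x (A : Set X), MeasurableSet A →
      ENNReal.ofReal ε * μ i A ≤ K i x A)
    (η η' : Measure X) [IsProbabilityMeasure η] [IsProbabilityMeasure η']
    (h : X → ℝ) (hh : Measurable h) (hbd : ∃ M, ∀ x, |h x| ≤ M) :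
    |(∫ x, h x ∂(List.foldl Measure.bind η (List.ofFn fun i => ⇑(K i)))) -
        ∫ x, h x ∂(List.foldl Measure.bind η' (List.ofFn fun i => ⇑(K i)))| ≤
      (1 - ε) ^ n * ⨆ p : X × X, |h p.1 - h p.2| := by

  obtain ⟨M, hM⟩ := hbd
  have hne : Nonempty X := nonempty_of_isProbabilityMeasure η
  have hB : BddAbove (Set.range h) := ⟨M, by rintro _ ⟨x, rfl⟩; exact (abs_le.1 (hM x)).2⟩
  have hA : BddBelow (Set.range h) := ⟨-M, by rintro _ ⟨x, rfl⟩; exact (abs_le.1 (hM x)).1⟩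
  refine (main_aux n K ε hε₀ μ hminor η η' h hh (⨅ x, h x) (⨆ x, h x)
    (fun x => ciInf_le hA x) (fun x => le_ciSup hB x)).trans ?_
  refine mul_le_mul_of_nonneg_left ?_ (pow_nonneg (by linarith) n)
  have hC : BddAbove (Set.range fun p : X × X => |h p.1 - h p.2|) := by
    refine ⟨M + M, ?_⟩
    rintro _ ⟨p, rfl⟩
    exact (abs_sub _ _).trans (add_le_add (hM _) (hM _))
  have h1 : ∀ x y, h x - h y ≤ ⨆ p : X × X, |h p.1 - h p.2| := fun x y =>
    (le_abs_self _).trans (le_ciSup hC (x, y))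
  have h2 : ∀ y, (⨆ x, h x) ≤ (⨆ p : X × X, |h p.1 - h p.2|) + h y := fun y =>
    ciSup_le fun x => by linarith [h1 x y]
  have h3 : (⨆ x, h x) - (⨆ p : X × X, |h p.1 - h p.2|) ≤ ⨅ x, h x :=
    le_ciInf fun y => by linarith [h2 y]
  linarith
end

section
/- Suppose the strong mixing condition holds, let g_1, …, g_T : X → (0, ∞) be bounded measurable functions, let η_0, …, η_{t−1} be probability measures on (X, 𝒳), let 0 ≤ s ≤ T and 1 ≤ t ≤ T, and let h : X → ℝ be bounded measurable. Let h̄_s : X^{T+1} → ℝ be the extension h̄_s(x_{0:T}) := h(x_s). Then for all x ∈ X, |G_{t,T}(x, h̄_s)| ≤ ρ^{|t−s|} · osc(h) · sup_{x'} F_{t,T}(x', 1), where ρ = 1 − σ₋/σ₊. -/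
open MeasureTheory Function

/-- The backward variable `L_{t,T}`, as a function of the number `k = T - t` of
remaining integration steps: `Laux ν m g T h k = L_{T-k,T}(·, h)`, viewed as a
function of a full path `ℕ → X` (it only depends on the coordinates `0, …, T-k`). -/
noncomputable def Laux {X : Type*} [MeasurableSpace X] (ν : Measure X)
    (m : X → X → ℝ) (g : ℕ → X → ℝ) (T : ℕ) (h : (ℕ → X) → ℝ) :
    ℕ → (ℕ → X) → ℝ
  | 0 => h
  | k + 1 => fun x =>
      ∫ y, m (x (T - (k + 1))) y * g (T - k) y *
        Laux ν m g T h k (Function.update x (T - k) y) ∂ν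

/-- `Lfun ν m g t T h = L_{t,T}(·, h)`:
`L_{t,T}(x_{0:t}, h) = ∫⋯∫ (∏_{u=t+1}^{T} m(x_{u−1}, x_u) g_u(x_u) ν(dx_u)) h(x_{0:T})`,
with `L_{T,T}(x_{0:T}, h) = h(x_{0:T})`. -/
noncomputable def Lfun {X : Type*} [MeasurableSpace X] (ν : Measure X)
    (m : X → X → ℝ) (g : ℕ → X → ℝ) (t T : ℕ) (h : (ℕ → X) → ℝ) :
    (ℕ → X) → ℝ :=
  Laux ν m g T h (T - t)

/-- Iterated backward-kernel integration: `backInt m η t φ x` is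
`∫⋯∫ B_{η_{t−1}}(x_t, dx_{t−1}) ⋯ B_{η_0}(x_1, dx_0) φ(x_{0:t}, …)`, where the
backward kernel associated with `η` is
`B_η(z, f) = (∫ m(y, z) f(y) η(dy)) / (∫ m(y, z) η(dy))`. -/
noncomputable def backInt {X : Type*} [MeasurableSpace X]
    (m : X → X → ℝ) (η : ℕ → Measure X) :
    ℕ → ((ℕ → X) → ℝ) → (ℕ → X) → ℝ
  | 0 => fun φ x => φ x
  | u + 1 => fun φ x =>
      (∫ y, m y (x (u + 1)) * backInt m η u φ (Function.update x u y) ∂(η u)) /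
        ∫ y, m y (x (u + 1)) ∂(η u)

/-- `Ffun ν m g η t T h = F_{t,T}(·, h)`:
`F_{t,T}(x_t, h) = ∫⋯∫ B_{η_{t−1}}(x_t, dx_{t−1}) ⋯ B_{η_0}(x_1, dx_0) L_{t,T}(x_{0:t}, h)`. -/
noncomputable def Ffun {X : Type*} [MeasurableSpace X] (ν : Measure X)
    (m : X → X → ℝ) (g : ℕ → X → ℝ) (η : ℕ → Measure X)
    (t T : ℕ) (h : (ℕ → X) → ℝ) : X → ℝ :=
  fun x => backInt m η t (Lfun ν m g t T h) (fun _ => x)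


/-- `Gfun ν m g η t T h = G_{t,T}(·, h)`:
`G_{t,T}(x, h) = F_{t,T}(x, h) − (η_{t−1}[F_{t−1,T}(·, h)] / η_{t−1}[F_{t−1,T}(·, 1)]) F_{t,T}(x, 1)`. -/
noncomputable def Gfun {X : Type*} [MeasurableSpace X] (ν : Measure X)
    (m : X → X → ℝ) (g : ℕ → X → ℝ) (η : ℕ → Measure X)
    (t T : ℕ) (h : (ℕ → X) → ℝ) : X → ℝ :=
  fun x =>
    Ffun ν m g η t T h x -
      ((∫ y, Ffun ν m g η (t - 1) T h y ∂(η (t - 1))) /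
          ∫ y, Ffun ν m g η (t - 1) T (fun _ => (1 : ℝ)) y ∂(η (t - 1))) *
        Ffun ν m g η t T (fun _ => (1 : ℝ)) x


/-- bounded measurable -/
def BM {X : Type*} [MeasurableSpace X] (f : X → ℝ) : Prop :=
  Measurable f ∧ ∃ M, ∀ x, |f x| ≤ M

lemma BM.mul {X : Type*} [MeasurableSpace X] {f g : X → ℝ} (hf : BM f) (hg : BM g) :
    BM (fun x => f x * g x) := by
  obtain ⟨hf, M, hM⟩ := hf
  obtain ⟨hg, N, hN⟩ := hg
  refine ⟨hf.mul hg, M * N, fun x => ?_⟩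
  rw [abs_mul]
  exact mul_le_mul (hM x) (hN x) (abs_nonneg _) ((abs_nonneg _).trans (hM x))

lemma BM.integrable {X : Type*} [MeasurableSpace X] {f : X → ℝ} (hf : BM f)
    (μ : Measure X) [IsProbabilityMeasure μ] : Integrable f μ := by
  obtain ⟨hf, M, hM⟩ := hf
  exact Integrable.of_bound hf.aestronglyMeasurable M (Filter.Eventually.of_forall hM)

lemma BM.of_mem {X : Type*} [MeasurableSpace X] {f : X → ℝ} (hf : Measurable f) (a b : ℝ)
    (h : ∀ x, a ≤ f x ∧ f x ≤ b) : BM f :=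
  ⟨hf, max |a| |b|, fun x => abs_le_max_abs_abs (h x).1 (h x).2⟩

lemma integral_pos_of_pos {X : Type*} [MeasurableSpace X] {f : X → ℝ} (hf : BM f)
    (hpos : ∀ x, 0 < f x) (μ : Measure X) [IsProbabilityMeasure μ] : 0 < ∫ x, f x ∂μ := by
  rw [integral_pos_iff_support_of_nonneg (fun x => (hpos x).le) (hf.integrable μ)]
  have : Function.support f = Set.univ := by
    ext x; simp [(hpos x).ne']
  rw [this]; simp

/-- Doeblin-type contraction for weighted averages. -/
lemma contraction {X : Type*} [MeasurableSpace X] (μ : Measure X) [IsProbabilityMeasure μ]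
    (f c w : X → ℝ) (hf : BM f) (hc : BM c) (hw : BM w) (hcpos : ∀ x, 0 < c x)
    (a b κ : ℝ) (ha : 0 < a) (hb : 0 < b) (hκ : 0 < κ)
    (hwc : ∀ x, a * κ * c x ≤ w x ∧ w x ≤ b * κ * c x)
    (lo C : ℝ) (hlo : ∀ x, lo ≤ f x ∧ f x ≤ lo + C) :
    (a / b * ((∫ y, c y * f y ∂μ) / ∫ y, c y ∂μ) + (1 - a / b) * lo
      ≤ (∫ y, w y * f y ∂μ) / ∫ y, w y ∂μ) ∧
    ((∫ y, w y * f y ∂μ) / ∫ y, w y ∂μ ≤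
      a / b * ((∫ y, c y * f y ∂μ) / ∫ y, c y ∂μ) + (1 - a / b) * lo + (1 - a / b) * C) := by
  have hwpos : ∀ x, 0 < w x := fun x =>
    lt_of_lt_of_le (mul_pos (mul_pos ha hκ) (hcpos x)) (hwc x).1
  have hD := integral_pos_of_pos hc hcpos μ
  have hW := integral_pos_of_pos hw hwpos μ
  have iw := hw.integrable μ
  have ic := hc.integrable μ
  have iwf := (hw.mul hf).integrable μ
  have icf := (hc.mul hf).integrable μ
  set D := ∫ y, c y ∂μ with hDdef
  set W := ∫ y, w y ∂μ with hWdef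
  have hWD : W ≤ b * κ * D := by
    rw [hDdef, ← integral_const_mul]
    exact integral_mono iw (ic.const_mul _) fun x => (hwc x).2
  have hr : ∀ x, 0 ≤ w x / W - a / b * (c x / D) := by
    intro x
    rw [sub_nonneg, div_mul_div_comm, div_le_div_iff₀ (by positivity) hW]
    calc a * c x * W ≤ a * c x * (b * κ * D) :=
          mul_le_mul_of_nonneg_left hWD (mul_pos ha (hcpos x)).le
      _ = (a * κ * c x) * (b * D) := by ring
      _ ≤ w x * (b * D) := mul_le_mul_of_nonneg_right (hwc x).1 (by positivity)
  have key : ∀ l : ℝ, ∫ y, (w y / W - a / b * (c y / D)) * (f y - l) ∂μ =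
      (∫ y, w y * f y ∂μ) / W - a / b * ((∫ y, c y * f y ∂μ) / D) - (1 - a / b) * l := by
    intro l
    have e : (fun y => (w y / W - a / b * (c y / D)) * (f y - l)) = fun y =>
        (W⁻¹ * (w y * f y) - (a / b / D) * (c y * f y)) -
          ((l * W⁻¹) * w y - (l * (a / b / D)) * c y) := by
      funext y; field_simp
    rw [e, integral_sub, integral_sub, integral_sub, integral_const_mul, integral_const_mul,
      integral_const_mul, integral_const_mul, ← hDdef, ← hWdef]
    · field_simp
    · exact iw.const_mul _
    · exact ic.const_mul _
    · exact iwf.const_mul _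
    · exact icf.const_mul _
    · exact (iwf.const_mul _).sub (icf.const_mul _)
    · exact (iw.const_mul _).sub (ic.const_mul _)
  constructor
  · have h1 : 0 ≤ ∫ y, (w y / W - a / b * (c y / D)) * (f y - lo) ∂μ :=
      integral_nonneg fun x => mul_nonneg (hr x) (by linarith [(hlo x).1])
    rw [key] at h1; linarith
  · have h1 : ∫ y, (w y / W - a / b * (c y / D)) * (f y - (lo + C)) ∂μ ≤ 0 :=
      integral_nonpos fun x => mul_nonpos_of_nonneg_of_nonpos (hr x) (by linarith [(hlo x).2])
    rw [key] at h1; linarith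

lemma avg_mem {X : Type*} [MeasurableSpace X] (μ : Measure X) [IsProbabilityMeasure μ]
    (N D : X → ℝ) (hN : BM N) (hD : BM D) (hDpos : ∀ x, 0 < D x) (lo C : ℝ)
    (h : ∀ x, lo * D x ≤ N x ∧ N x ≤ (lo + C) * D x) :
    lo ≤ (∫ y, N y ∂μ) / (∫ y, D y ∂μ) ∧ (∫ y, N y ∂μ) / (∫ y, D y ∂μ) ≤ lo + C := by
  have hp := integral_pos_of_pos hD hDpos μ
  rw [le_div_iff₀ hp, div_le_iff₀ hp, ← integral_const_mul, ← integral_const_mul]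
  exact ⟨integral_mono ((hD.integrable μ).const_mul _) (hN.integrable μ) fun x => (h x).1,
    integral_mono (hN.integrable μ) ((hD.integrable μ).const_mul _) fun x => (h x).2⟩

/-- `L_{T-k,T}(x,1)` as a function of one variable. -/
noncomputable def L1 {X : Type*} [MeasurableSpace X] (ν : Measure X)
    (m : X → X → ℝ) (g : ℕ → X → ℝ) (T : ℕ) : ℕ → X → ℝ
  | 0 => fun _ => 1
  | k + 1 => fun x => ∫ y, m x y * g (T - k) y * L1 ν m g T k y ∂ν

/-- forward normalised functions -/
noncomputable def phiF {X : Type*} [MeasurableSpace X] (ν : Measure X)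
    (m : X → X → ℝ) (g : ℕ → X → ℝ) (T s : ℕ) (h : X → ℝ) : ℕ → X → ℝ
  | 0 => h
  | j + 1 => fun x =>
      (∫ y, m x y * (g (s - j) y * L1 ν m g T (T - s + j) y) * phiF ν m g T s h j y ∂ν) /
        ∫ y, m x y * (g (s - j) y * L1 ν m g T (T - s + j) y) ∂ν

/-- backward functions -/
noncomputable def psiB {X : Type*} [MeasurableSpace X]
    (m : X → X → ℝ) (η : ℕ → Measure X) (s : ℕ) (h : X → ℝ) : ℕ → X → ℝ
  | 0 => h
  | j + 1 => fun x =>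
      (∫ y, m y x * psiB m η s h j y ∂(η (s + j))) / ∫ y, m y x ∂(η (s + j))

lemma meas_int {X : Type*} [MeasurableSpace X] (ν : Measure X) [IsProbabilityMeasure ν]
    (m : X → X → ℝ) (hm : Measurable (Function.uncurry m)) (f : X → ℝ) (hf : Measurable f) :
    Measurable fun x => ∫ y, m x y * f y ∂ν := by
  have : StronglyMeasurable (fun p : X × X => m p.1 p.2 * f p.2) :=
    (hm.mul (hf.comp measurable_snd)).stronglyMeasurable
  exact this.integral_prod_right.measurable

section main
variable {X : Type*} [MeasurableSpace X]
    (ν : Measure X) [IsProbabilityMeasure ν]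
    (m : X → X → ℝ) (hm : Measurable (Function.uncurry m))
    (σm σp : ℝ) (hσm : 0 < σm) (hσ : σm ≤ σp)
    (hmix : ∀ x y, σm ≤ m x y ∧ m x y ≤ σp)
    (g : ℕ → X → ℝ) (hgmeas : ∀ u, Measurable (g u)) (hgpos : ∀ u x, 0 < g u x)
    (hgbd : ∀ u, ∃ M, ∀ x, g u x ≤ M)
    (η : ℕ → Measure X) [∀ u, IsProbabilityMeasure (η u)]

lemma L1_succ' (T k : ℕ) (x : X) : L1 ν m g T (k+1) x =
    ∫ y, m x y * (g (T - k) y * L1 ν m g T k y) ∂ν := by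
  simp only [L1, mul_assoc]

lemma BM_left (hm : Measurable (Function.uncurry m))
    (hmix : ∀ x y, σm ≤ m x y ∧ m x y ≤ σp) (x : X) : BM (fun y => m x y) :=
  BM.of_mem (hm.comp measurable_prodMk_left) σm σp fun y => hmix x y

lemma BM_right (hm : Measurable (Function.uncurry m))
    (hmix : ∀ x y, σm ≤ m x y ∧ m x y ≤ σp) (x : X) : BM (fun y => m y x) :=
  BM.of_mem (hm.comp measurable_prodMk_right) σm σp fun y => hmix y x

lemma BM_g (hgmeas : ∀ u, Measurable (g u)) (hgpos : ∀ u x, 0 < g u x)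
    (hgbd : ∀ u, ∃ M, ∀ x, g u x ≤ M) (u : ℕ) : BM (g u) := by
  obtain ⟨M, hM⟩ := hgbd u
  exact BM.of_mem (hgmeas u) 0 M fun x => ⟨(hgpos u x).le, hM x⟩

include hm hσm hmix in
lemma int_bounds (c : X → ℝ) (hc : BM c) (hcpos : ∀ x, 0 < c x) :
    BM (fun x => ∫ y, m x y * c y ∂ν) ∧ (∀ x, 0 < ∫ y, m x y * c y ∂ν) ∧
    ∀ x, σm * (∫ y, c y ∂ν) ≤ ∫ y, m x y * c y ∂ν ∧
      ∫ y, m x y * c y ∂ν ≤ σp * (∫ y, c y ∂ν) := by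
  have hb : ∀ x, σm * (∫ y, c y ∂ν) ≤ ∫ y, m x y * c y ∂ν ∧
      ∫ y, m x y * c y ∂ν ≤ σp * (∫ y, c y ∂ν) := by
    intro x
    have i1 := ((BM_left m σm σp hm hmix x).mul hc).integrable ν
    have i2 := hc.integrable ν
    rw [← integral_const_mul, ← integral_const_mul]
    exact ⟨integral_mono (i2.const_mul _) i1 fun y =>
        mul_le_mul_of_nonneg_right (hmix x y).1 (hcpos y).le,
      integral_mono i1 (i2.const_mul _) fun y =>
        mul_le_mul_of_nonneg_right (hmix x y).2 (hcpos y).le⟩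
  refine ⟨BM.of_mem (meas_int ν m hm c hc.1) _ _ hb, fun x => ?_, hb⟩
  exact lt_of_lt_of_le (mul_pos hσm (integral_pos_of_pos hc hcpos ν)) (hb x).1

include hm hσm hmix hgmeas hgpos hgbd in
lemma L1_props (T k : ℕ) : BM (L1 ν m g T k) ∧ ∀ x, 0 < L1 ν m g T k x := by
  induction k with
  | zero => exact ⟨BM.of_mem measurable_const 1 1 (by simp [L1]), by simp [L1]⟩
  | succ k ih =>
    have h := int_bounds ν m hm σm σp hσm hmix (fun y => g (T - k) y * L1 ν m g T k y)
      ((BM_g g hgmeas hgpos hgbd _).mul ih.1) (fun x => mul_pos (hgpos _ x) (ih.2 x))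
    have e : L1 ν m g T (k+1) = fun x => ∫ y, m x y * (g (T - k) y * L1 ν m g T k y) ∂ν := by
      funext x; exact L1_succ' ν m g T k x
    rw [e]; exact ⟨h.1, h.2.1⟩

lemma Laux_one (T k : ℕ) (p : ℕ → X) :
    Laux ν m g T (fun _ => (1:ℝ)) k p = L1 ν m g T k (p (T - k)) := by
  induction k generalizing p with
  | zero => rfl
  | succ k ih => simp only [Laux, L1, ih, Function.update_self]

lemma Laux_h (T s k : ℕ) (h : X → ℝ) (hk : s + k ≤ T) (p : ℕ → X) :
    Laux ν m g T (fun p => h (p s)) k p = L1 ν m g T k (p (T - k)) * h (p s) := by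
  induction k generalizing p with
  | zero => simp [Laux, L1]
  | succ k ih =>
    have hne : s ≠ T - k := by omega
    simp only [Laux, L1, ih (by omega), Function.update_self, Function.update_of_ne hne,
      ← mul_assoc]
    rw [integral_mul_const]

include hm hσm hmix hgmeas hgpos hgbd in
lemma Laux_h' (T s j : ℕ) (h : X → ℝ) (hs : s ≤ T) (hj : j ≤ s) (p : ℕ → X) :
    Laux ν m g T (fun p => h (p s)) (T - s + j) p =
      L1 ν m g T (T - s + j) (p (s - j)) * phiF ν m g T s h j (p (s - j)) := by
  induction j generalizing p with
  | zero =>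
    have := Laux_h ν m g T s (T - s) h (by omega) p
    rw [show T - (T - s) = s by omega] at this
    simpa [phiF] using this
  | succ j ih =>
    have e1 : T - (T - s + j) = s - j := by omega
    have e2 : T - (T - s + j + 1) = s - (j + 1) := by omega
    have hpos := (L1_props ν m hm σm σp hσm hmix g hgmeas hgpos hgbd T (T - s + j + 1)).2
      (p (s - (j+1)))
    rw [← add_assoc, phiF]
    rw [L1_succ', e1] at hpos ⊢
    rw [mul_div_cancel₀ _ hpos.ne']
    simp only [Laux, e1, e2, ih (by omega), Function.update_self]
    congr 1; funext y; ring

include hm hσm hσ hmix hgmeas hgpos hgbd in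
lemma phiF_props (T s : ℕ) (h : X → ℝ) (hh : Measurable h) (lo C : ℝ)
    (hlo : ∀ x, lo ≤ h x ∧ h x ≤ lo + C) (j : ℕ) :
    Measurable (phiF ν m g T s h j) ∧ ∃ l, ∀ x, l ≤ phiF ν m g T s h j x ∧
      phiF ν m g T s h j x ≤ l + (1 - σm / σp) ^ j * C := by
  induction j with
  | zero => exact ⟨hh, lo, by simpa [phiF] using hlo⟩
  | succ j ih =>
    obtain ⟨hmeas, l, hl⟩ := ih
    have hL := L1_props ν m hm σm σp hσm hmix g hgmeas hgpos hgbd T (T - s + j)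
    have hc := (BM_g g hgmeas hgpos hgbd (s - j)).mul hL.1
    have hcpos : ∀ x, 0 < g (s - j) x * L1 ν m g T (T - s + j) x :=
      fun x => mul_pos (hgpos _ x) (hL.2 x)
    have hphi : BM (phiF ν m g T s h j) := BM.of_mem hmeas _ _ hl
    constructor
    · simp only [phiF]
      refine Measurable.div ?_ (meas_int ν m hm _ hc.1)
      simp only [mul_assoc]
      simp only [← mul_assoc (g _ _)]
      exact meas_int ν m hm _ (hc.mul hphi).1
    · have := fun x => contraction ν (phiF ν m g T s h j) _ _ hphi hc
        ((BM_left m σm σp hm hmix x).mul hc) hcpos σm σp 1 hσm (hσm.trans_le hσ) one_pos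
        (fun y => ⟨by
          have := mul_le_mul_of_nonneg_right (hmix x y).1 (hcpos y).le
          simpa using this, by
          have := mul_le_mul_of_nonneg_right (hmix x y).2 (hcpos y).le
          simpa using this⟩) l _ hl
      rw [pow_succ', mul_assoc]
      exact ⟨_, this⟩

include hm hσm hσ hmix in
lemma psiB_props (s : ℕ) (h : X → ℝ) (hh : Measurable h) (lo C : ℝ)
    (hlo : ∀ x, lo ≤ h x ∧ h x ≤ lo + C) (j : ℕ) :
    BM (psiB m η s h j) ∧ ∃ l, ∀ x, l ≤ psiB m η s h j x ∧
      psiB m η s h j x ≤ l + (1 - σm / σp) ^ j * C := by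
  induction j with
  | zero => exact ⟨BM.of_mem hh _ _ hlo, lo, by simpa [psiB] using hlo⟩
  | succ j ih =>
    obtain ⟨hpsi, l, hl⟩ := ih
    have hb : ∃ l, ∀ x, l ≤ psiB m η s h (j+1) x ∧
      psiB m η s h (j+1) x ≤ l + (1 - σm / σp) ^ (j+1) * C := by
      have := fun x => contraction (η (s+j)) (psiB m η s h j) (fun _ => 1) _ hpsi
        (BM.of_mem measurable_const 1 1 (by simp))
        (BM_right m σm σp hm hmix x) (by simp) σm σp 1 hσm (hσm.trans_le hσ) one_pos
        (fun y => by simpa using hmix y x) l _ hl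
      rw [pow_succ', mul_assoc]
      exact ⟨_, this⟩
    refine ⟨?_, hb⟩
    obtain ⟨l', hl'⟩ := hb
    refine BM.of_mem ?_ _ _ hl'
    have hm' : Measurable (Function.uncurry fun x y => m y x) := hm.comp measurable_swap
    have h1 := meas_int (η (s+j)) (fun x y => m y x) hm' (fun _ => 1) measurable_const
    simp only [mul_one] at h1
    exact (meas_int (η (s+j)) (fun x y => m y x) hm' _ hpsi.1).div h1

include hm hσm hmix in
lemma backInt_const (u : ℕ) (Φ : (ℕ → X) → ℝ)
    (hΦ : ∀ v < u, ∀ p y, Φ (Function.update p v y) = Φ p) (p : ℕ → X) :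
    backInt m η u Φ p = Φ p := by
  induction u generalizing p with
  | zero => rfl
  | succ u ih =>
    have hpos : 0 < ∫ y, m y (p (u+1)) ∂(η u) :=
      integral_pos_of_pos (BM_right m σm σp hm hmix _) (fun y => hσm.trans_le (hmix y _).1) _
    simp only [backInt, ih (fun v hv => hΦ v (by omega)), hΦ u (by omega)]
    rw [integral_mul_const, mul_div_cancel_left₀ _ hpos.ne']

include hm hσm hmix in
lemma backInt_h (s t j : ℕ) (hj : s + j ≤ t) (a h : X → ℝ) (p : ℕ → X) :
    backInt m η (s + j) (fun p => a (p t) * h (p s)) p =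
      a (p t) * psiB m η s h j (p (s + j)) := by
  induction j generalizing p with
  | zero =>
    refine backInt_const m hm σm σp hσm hmix η s _ (fun v hv p y => ?_) p
    rw [Function.update_of_ne (by omega), Function.update_of_ne (by omega)]
  | succ j ih =>
    have hne : t ≠ s + j := by omega
    rw [← add_assoc]
    simp only [backInt, psiB, ih (by omega), Function.update_self, Function.update_of_ne hne]
    rw [← mul_div_assoc, ← integral_const_mul]
    congr 2; funext y; ring

include hm hσm hmix in
lemma F_one (t T : ℕ) (ht : t ≤ T) (x : X) :
    Ffun ν m g η t T (fun _ => (1 : ℝ)) x = L1 ν m g T (T - t) x := by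
  have e : Lfun ν m g t T (fun _ => (1 : ℝ)) = fun p => L1 ν m g T (T - t) (p t) := by
    funext p
    rw [Lfun, Laux_one, show T - (T - t) = t by omega]
  rw [Ffun, e]
  exact backInt_const m hm σm σp hσm hmix η t _ (fun v hv p y => by
    rw [Function.update_of_ne (by omega)]) _

include hm hσm hmix hgmeas hgpos hgbd in
/-- forward case `t ≤ s` -/
lemma F_fwd (s t T : ℕ) (hs : s ≤ T) (hts : t ≤ s) (h : X → ℝ) (x : X) :
    Ffun ν m g η t T (fun p => h (p s)) x =
      L1 ν m g T (T - t) x * phiF ν m g T s h (s - t) x := by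
  have e : Lfun ν m g t T (fun p => h (p s)) =
      fun p => L1 ν m g T (T - t) (p t) * phiF ν m g T s h (s - t) (p t) := by
    funext p
    have := Laux_h' ν m hm σm σp hσm hmix g hgmeas hgpos hgbd T s (s - t) h hs (by omega) p
    rw [show T - s + (s - t) = T - t by omega, show s - (s - t) = t by omega] at this
    exact this
  rw [Ffun, e]
  exact backInt_const m hm σm σp hσm hmix η t _ (fun v hv p y => by
    rw [Function.update_of_ne (by omega)]) _

include hm hσm hmix in
/-- backward case `s ≤ t` -/
lemma F_bwd (s j T : ℕ) (hs : s + j ≤ T) (h : X → ℝ) (x : X) :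
    Ffun ν m g η (s + j) T (fun p => h (p s)) x =
      L1 ν m g T (T - (s + j)) x * psiB m η s h j x := by
  have e : Lfun ν m g (s + j) T (fun p => h (p s)) =
      fun p => L1 ν m g T (T - (s + j)) (p (s + j)) * h (p s) := by
    funext p
    rw [Lfun, Laux_h ν m g T s _ h (by omega), show T - (T - (s + j)) = s + j by omega]
  rw [Ffun, e]
  exact backInt_h m hm σm σp hσm hmix η s (s + j) j le_rfl _ h _

end main


/-- Time-uniform bound on `G_{t,T}` for marginal smoothing (Lemma 7 of the paper):
under the strong mixing condition, for the extension `h̄_s(x_{0:T}) = h(x_s)`,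
`|G_{t,T}(x, h̄_s)| ≤ ρ^{|t−s|} osc(h) sup_{x'} F_{t,T}(x', 1)` with `ρ = 1 − σ₋/σ₊`. -/
theorem stmt_10 {X : Type*} [MeasurableSpace X]
    (ν : Measure X) [IsProbabilityMeasure ν]
    (m : X → X → ℝ) (hm : Measurable (Function.uncurry m))
    (σm σp : ℝ) (hσm : 0 < σm) (hσ : σm ≤ σp)
    (hmix : ∀ x y, σm ≤ m x y ∧ m x y ≤ σp)
    (g : ℕ → X → ℝ) (hgmeas : ∀ u, Measurable (g u)) (hgpos : ∀ u x, 0 < g u x)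
    (hgbd : ∀ u, ∃ M, ∀ x, g u x ≤ M)
    (η : ℕ → Measure X) [∀ u, IsProbabilityMeasure (η u)]
    (s t T : ℕ) (hs : s ≤ T) (ht₁ : 1 ≤ t) (ht₂ : t ≤ T)
    (h : X → ℝ) (hhmeas : Measurable h) (hhbd : ∃ M, ∀ x, |h x| ≤ M) :
    ∀ x : X,
      |Gfun ν m g η t T (fun p => h (p s)) x| ≤
        (1 - σm / σp) ^ ((t : ℤ) - (s : ℤ)).natAbs *
          (⨆ p : X × X, |h p.1 - h p.2|) *
          ⨆ x' : X, Ffun ν m g η t T (fun _ => (1 : ℝ)) x' := by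
  intro x
  obtain ⟨M, hM⟩ := hhbd
  set C := ⨆ p : X × X, |h p.1 - h p.2| with hC
  have hσp : 0 < σp := hσm.trans_le hσ
  have hosc : ∀ a b, h a - h b ≤ C := fun a b => by
    have hbd : BddAbove (Set.range fun p : X × X => |h p.1 - h p.2|) := by
      refine ⟨M + M, ?_⟩
      rintro _ ⟨p, rfl⟩
      exact (abs_sub _ _).trans (add_le_add (hM _) (hM _))
    exact (le_abs_self _).trans (le_ciSup hbd (a, b))
  haveI : Nonempty X := ⟨x⟩
  have hlo : ∀ y, (⨅ z, h z) ≤ h y ∧ h y ≤ (⨅ z, h z) + C := by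
    intro y
    refine ⟨ciInf_le ⟨-M, ?_⟩ y, ?_⟩
    · rintro _ ⟨z, rfl⟩
      exact (abs_le.1 (hM z)).1
    · have : h y - C ≤ ⨅ z, h z := le_ciInf fun z => by linarith [hosc y z]
      linarith
  generalize (⨅ z, h z) = lo at hlo
  obtain ⟨hL, hLpos⟩ := L1_props ν m hm σm σp hσm hmix g hgmeas hgpos hgbd T (T - t)
  obtain ⟨hL', hLpos'⟩ := L1_props ν m hm σm σp hσm hmix g hgmeas hgpos hgbd T (T - (t - 1))
  have hsup : L1 ν m g T (T - t) x ≤ ⨆ x' : X, L1 ν m g T (T - t) x' := by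
    obtain ⟨_, K, hK⟩ := hL
    refine le_ciSup (f := fun x' => L1 ν m g T (T - t) x') ⟨K, ?_⟩ x
    rintro _ ⟨z, rfl⟩
    exact (le_abs_self _).trans (hK z)
  have e1 : ∀ x, Ffun ν m g η t T (fun _ => (1 : ℝ)) x = L1 ν m g T (T - t) x :=
    F_one ν m hm σm σp hσm hmix g η t T ht₂
  have e2 : ∀ x, Ffun ν m g η (t - 1) T (fun _ => (1 : ℝ)) x = L1 ν m g T (T - (t - 1)) x :=
    F_one ν m hm σm σp hσm hmix g η (t - 1) T (by omega)
  have eL : ∀ y, L1 ν m g T (T - (t - 1)) y =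
      ∫ z, m y z * (g t z * L1 ν m g T (T - t) z) ∂ν := by
    intro y
    rw [show T - (t - 1) = T - t + 1 by omega, L1_succ', show T - (T - t) = t by omega]
  have hc := (BM_g g hgmeas hgpos hgbd t).mul hL
  have hcpos : ∀ z, 0 < g t z * L1 ν m g T (T - t) z := fun z => mul_pos (hgpos t z) (hLpos z)
  set ρC := (1 - σm / σp) ^ ((t : ℤ) - (s : ℤ)).natAbs * C with hρC
  suffices hmain : ∃ l ψ : ℝ, Ffun ν m g η t T (fun p => h (p s)) x =
      L1 ν m g T (T - t) x * ψ ∧ (l ≤ ψ ∧ ψ ≤ l + ρC) ∧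
      (l ≤ (∫ y, Ffun ν m g η (t - 1) T (fun p => h (p s)) y ∂(η (t - 1))) /
          ∫ y, L1 ν m g T (T - (t - 1)) y ∂(η (t - 1)) ∧
        (∫ y, Ffun ν m g η (t - 1) T (fun p => h (p s)) y ∂(η (t - 1))) /
          ∫ y, L1 ν m g T (T - (t - 1)) y ∂(η (t - 1)) ≤ l + ρC) by
    obtain ⟨l, ψ, hF, hψ, hA⟩ := hmain
    simp only [Gfun, e1, e2, hF]
    generalize (∫ y, Ffun ν m g η (t - 1) T (fun p => h (p s)) y ∂(η (t - 1))) /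
          ∫ y, L1 ν m g T (T - (t - 1)) y ∂(η (t - 1)) = A at hA
    have h1 : |ψ - A| ≤ ρC := abs_le.2 ⟨by linarith [hψ.1, hA.2], by linarith [hψ.2, hA.1]⟩
    rw [show L1 ν m g T (T - t) x * ψ - A * L1 ν m g T (T - t) x =
      (ψ - A) * L1 ν m g T (T - t) x by ring, abs_mul, abs_of_pos (hLpos x)]
    exact mul_le_mul h1 hsup (hLpos x).le ((abs_nonneg _).trans h1)
  rcases le_or_gt t s with hts | hst
  · obtain ⟨hφm, l, hl⟩ := phiF_props ν m hm σm σp hσm hσ hmix g hgmeas hgpos hgbd T s h hhmeas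
      lo C hlo (s - t)
    rw [show s - t = ((t : ℤ) - (s : ℤ)).natAbs by omega, ← hρC] at hl
    rw [show ((t : ℤ) - (s : ℤ)).natAbs = s - t by omega] at hl
    have hφ : BM (phiF ν m g T s h (s - t)) := BM.of_mem hφm _ _ hl
    refine ⟨l, _, F_fwd ν m hm σm σp hσm hmix g hgmeas hgpos hgbd η s t T hs hts h x, hl x, ?_⟩
    have eF : ∀ y, Ffun ν m g η (t - 1) T (fun p => h (p s)) y =
        ∫ z, m y z * (g t z * L1 ν m g T (T - t) z * phiF ν m g T s h (s - t) z) ∂ν := by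
      intro y
      rw [F_fwd ν m hm σm σp hσm hmix g hgmeas hgpos hgbd η s (t - 1) T hs (by omega) h y,
        show s - (t - 1) = s - t + 1 by omega, phiF, show T - s + (s - t) = T - t by omega,
        show s - (s - t) = t by omega]
      beta_reduce
      rw [← eL, mul_div_cancel₀ _ (hLpos' y).ne']
      simp only [mul_assoc]
    have hb : ∀ y, l * L1 ν m g T (T - (t - 1)) y ≤ Ffun ν m g η (t - 1) T (fun p => h (p s)) y ∧
        Ffun ν m g η (t - 1) T (fun p => h (p s)) y ≤ (l + ρC) * L1 ν m g T (T - (t - 1)) y := by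
      intro y
      rw [eF, eL, ← integral_const_mul, ← integral_const_mul]
      have i1 := ((BM_left m σm σp hm hmix y).mul hc).integrable ν
      have i2 := ((BM_left m σm σp hm hmix y).mul (hc.mul hφ)).integrable ν
      have hp : ∀ z, 0 ≤ m y z * (g t z * L1 ν m g T (T - t) z) := fun z =>
        mul_nonneg (hσm.le.trans (hmix y z).1) (hcpos z).le
      constructor
      · refine integral_mono (i1.const_mul _) i2 fun z => ?_
        have := mul_le_mul_of_nonneg_right (hl z).1 (hp z)
        simp only; linarith
      · refine integral_mono i2 (i1.const_mul _) fun z => ?_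
        have := mul_le_mul_of_nonneg_right (hl z).2 (hp z)
        simp only; linarith
    refine avg_mem (η (t - 1)) _ _ ?_ hL' hLpos' l ρC hb
    have hFm : Measurable fun y => Ffun ν m g η (t - 1) T (fun p => h (p s)) y := by
      simp only [eF]
      exact meas_int ν m hm _ (hc.mul hφ).1
    obtain ⟨K, hK⟩ := hL'.2
    refine ⟨hFm, max |l| |l + ρC| * K, fun y => ?_⟩
    have h1 : |Ffun ν m g η (t - 1) T (fun p => h (p s)) y| ≤
        max |l * L1 ν m g T (T - (t - 1)) y| |(l + ρC) * L1 ν m g T (T - (t - 1)) y| :=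
      abs_le_max_abs_abs (hb y).1 (hb y).2
    refine h1.trans ?_
    rw [abs_mul, abs_mul]
    refine max_le ?_ ?_
    · exact mul_le_mul (le_max_left _ _) (hK y) (abs_nonneg _) (by positivity)
    · exact mul_le_mul (le_max_right _ _) (hK y) (abs_nonneg _) (by positivity)
  · obtain ⟨j, rfl⟩ : ∃ j, t = s + j + 1 := ⟨t - s - 1, by omega⟩
    simp only [Nat.add_sub_cancel] at *
    obtain ⟨hψ, l, hl⟩ := psiB_props m hm σm σp hσm hσ hmix η s h hhmeas lo C hlo j
    have hρ : ρC = (1 - σm / σp) * ((1 - σm / σp) ^ j * C) := by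
      rw [hρC, show (((s + j + 1 : ℕ) : ℤ) - (s : ℤ)).natAbs = j + 1 by omega]; ring
    have hone : BM (fun _ : X => (1 : ℝ)) := BM.of_mem measurable_const 1 1 (by simp)
    have eF : ∀ y, Ffun ν m g η (s + j) T (fun p => h (p s)) y =
        L1 ν m g T (T - (s + j)) y * psiB m η s h j y :=
      F_bwd ν m hm σm σp hσm hmix g η s j T (by omega) h
    simp only [eF]
    rw [hρ]
    have h1 := contraction (η (s + j)) (psiB m η s h j) (fun _ => 1) _ hψ hone hL' (by simp) σm σp
        (∫ z, g (s + j + 1) z * L1 ν m g T (T - (s + j + 1)) z ∂ν) hσm hσp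
        (integral_pos_of_pos hc hcpos ν) (fun y => by
          rw [eL, mul_one, mul_one]
          exact (int_bounds ν m hm σm σp hσm hmix _ hc hcpos).2.2 y) l _ hl
    have h2 := contraction (η (s + j)) (psiB m η s h j) (fun _ => 1) _ hψ hone
        (BM_right m σm σp hm hmix x) (by simp) σm σp 1 hσm hσp one_pos
        (fun y => by simpa using hmix y x) l _ hl
    exact ⟨_, _, F_bwd ν m hm σm σp hσm hmix g η s (j + 1) T (by omega) h x, h2, h1⟩
end
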